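/- Let d be a positive even integer and let X = [[z√ε, u√ε],[v√ε, z√ε]] with z, u, v ∈ F, ν(z) ≥ −d and ν(v) > ν(u) = −d. Then { h ∈ T(X)·K_{d/2} : h·J_d·h^{-1} = J_d and Ψ_X(h·g·h^{-1}) = Ψ_X(g) for all g ∈ J_d } = T(X)·J_d, the set of products t·j with t ∈ T(X) and j ∈ J_d. -/

import Mathlib

open Matrix

noncomputable section

/-- A 2×2 matrix over `E`. -/
abbrev Mat (E : Type) := Matrix (Fin 2) (Fin 2) E

/-- The context: `E/F` is the unramified quadratic extension of a finite extension `F` of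
`ℚ_p` (`p` odd), encoded via the Galois involution `sig` (whose fixed field is `F`),
the valuation `nu` (normalized by `nu ϖ = 1` for a uniformizer `ϖ` of `F`),
a square root `sqeps` of a non-square unit `eps = sqeps^2` of `O_F`, the residue-field
cardinality `q` of `F`, and an additive character `psi'` of `F` trivial on `p_F` and
nontrivial on `O_F`. -/
structure USetting (E : Type) [Field E] where
  sig : E →+* E
  nu : E → WithTop ℤ
  sqeps : E
  pi : E
  q : ℕ
  psi' : E → ℂ
  sig_invol : ∀ x, sig (sig x) = x
  sig_ne : ∃ x, sig x ≠ x
  nu_eq_top : ∀ x, nu x = ⊤ ↔ x = 0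
  nu_mul : ∀ x y, nu (x * y) = nu x + nu y
  nu_add : ∀ x y, min (nu x) (nu y) ≤ nu (x + y)
  nu_sig : ∀ x, nu (sig x) = nu x
  nu_pi : nu pi = 1
  sig_pi : sig pi = pi
  sig_sqeps : sig sqeps = - sqeps
  nu_sqeps : nu sqeps = 0
  eps_not_square : ∀ y, sig y = y → y * y ≠ sqeps * sqeps
  gen : ∀ x : E, ∃ a b, sig a = a ∧ sig b = b ∧ x = a + b * sqeps
  nu_two : nu 2 = 0
  charzero : ∀ n : ℕ, (n : E) = 0 → n = 0
  complete : ∀ f : ℕ → E, (∀ n : ℕ, ((n : ℤ) : WithTop ℤ) ≤ nu (f (n + 1) - f n)) →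
    ∃ L, ∀ n : ℕ, ((n : ℤ) : WithTop ℤ) ≤ nu (L - f n)
  res_card : ∃ R : Finset E, R.card = q ∧ (∀ x ∈ R, sig x = x ∧ 0 ≤ nu x) ∧
    ∀ y : E, sig y = y → 0 ≤ nu y → ∃! x, x ∈ R ∧ 1 ≤ nu (y - x)
  psi'_mul : ∀ x y, sig x = x → sig y = y → psi' (x + y) = psi' x * psi' y
  psi'_ne : ∀ x, sig x = x → psi' x ≠ 0
  psi'_triv : ∀ x, sig x = x → 1 ≤ nu x → psi' x = 1
  psi'_nontriv : ∃ x, sig x = x ∧ 0 ≤ nu x ∧ psi' x ≠ 1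

variable {E : Type} [Field E]

/-- The matrix `w₀ = [[0,1],[1,0]]`. -/
def w0 (E : Type) [Field E] : Mat E := !![0, 1; 1, 0]

/-- `G = U(1,1)(F)`. -/
def Gset (S : USetting E) : Set (Mat E) :=
  {g | (g.map ⇑S.sig)ᵀ * w0 E * g = w0 E}

/-- `K = G ∩ GL₂(O_E)`: entries in `O_E` and determinant in `O_E^×`. -/
def Kset (S : USetting E) : Set (Mat E) :=
  {g | g ∈ Gset S ∧ (∀ i j, 0 ≤ S.nu (g i j)) ∧ S.nu g.det = 0}

/-- The congruence filtration subgroup `K_n` (for `n ≥ 1`; `K_0 = K` as a set). -/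
def Kfil (S : USetting E) (n : ℤ) : Set (Mat E) :=
  {g | g ∈ Kset S ∧ ∀ i j, (n : WithTop ℤ) ≤ S.nu ((g - 1) i j)}

/-- `𝓑 = B ∩ K`, the upper triangular matrices in `K`. -/
def Bcal (S : USetting E) : Set (Mat E) := {g | g ∈ Kset S ∧ g 1 0 = 0}

/-- `E^1`, the norm-one elements of `E`. -/
def E1set (S : USetting E) : Set E := {x | x * S.sig x = 1}

/-- `O_F^×` as a subset of `E`. -/
def OFunits (S : USetting E) : Set E := {x | S.sig x = x ∧ S.nu x = 0}

/-- `O_E^×` as a subset of `E`. -/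
def OEunits (S : USetting E) : Set E := {x | S.nu x = 0}

/-- A character of `E^×`, encoded as a function `E → ℂ` multiplicative and
nonvanishing on nonzero elements. -/
def IsChar (χ : E → ℂ) : Prop :=
  (∀ x y : E, x ≠ 0 → y ≠ 0 → χ (x * y) = χ x * χ y) ∧ ∀ x : E, x ≠ 0 → χ x ≠ 0

/-- A group homomorphism `E^1 → ℂ^×`, encoded as a function `E → ℂ`. -/
def IsE1Hom (S : USetting E) (φ : E → ℂ) : Prop :=
  (∀ x ∈ E1set S, ∀ y ∈ E1set S, φ (x * y) = φ x * φ y) ∧ ∀ x ∈ E1set S, φ x ≠ 0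

/-- A homomorphism into `ℂ^×` on a subset of matrices. -/
def IsHomOn (A : Set (Mat E)) (Ψ : Mat E → ℂ) : Prop :=
  (∀ x ∈ A, ∀ y ∈ A, Ψ (x * y) = Ψ x * Ψ y) ∧ ∀ x ∈ A, Ψ x ≠ 0

/-- `1 + p_E^n`. -/
def onePE (S : USetting E) (n : ℤ) : Set E := {x | (n : WithTop ℤ) ≤ S.nu (x - 1)}

/-- `1 + p_F^n`. -/
def onePF (S : USetting E) (n : ℤ) : Set E :=
  {x | S.sig x = x ∧ (n : WithTop ℤ) ≤ S.nu (x - 1)}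

/-- `χ` is trivial on a set. -/
def TrivOn (χ : E → ℂ) (s : Set E) : Prop := ∀ x ∈ s, χ x = 1

/-- `χ` has depth `r`: trivial on `1+p_E^{r+1}` and (if `r ≥ 1`) nontrivial on `1+p_E^r`. -/
def HasDepth (S : USetting E) (χ : E → ℂ) (r : ℕ) : Prop :=
  TrivOn χ (onePE S ((r : ℤ) + 1)) ∧ (r = 0 ∨ ¬ TrivOn χ (onePE S (r : ℤ)))

/-- `χ` has true depth `r`: the depth of its restriction to `F^×` is `r`. -/
def HasTrueDepth (S : USetting E) (χ : E → ℂ) (r : ℕ) : Prop :=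
  TrivOn χ (onePF S ((r : ℤ) + 1)) ∧ (r = 0 ∨ ¬ TrivOn χ (onePF S (r : ℤ)))

/-- `χ` has minimal depth `r`: its depth and true depth both equal `r`. -/
def MinDepth (S : USetting E) (χ : E → ℂ) (r : ℕ) : Prop :=
  HasDepth S χ r ∧ HasTrueDepth S χ r

/-- Right translation action on functions. -/
def rho (g : Mat E) : (Mat E → ℂ) →ₗ[ℂ] (Mat E → ℂ) where
  toFun f := fun k => f (k * g)
  map_add' _ _ := rfl
  map_smul' _ _ := rfl

/-- The space `V_χ^{K_n}`: functions on `K` (extended by zero off `K`) satisfying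
`f(bk) = χ(b₁₁) f(k)` for `b ∈ 𝓑` and right `K_n`-invariance. -/
def Vsp (S : USetting E) (χ : E → ℂ) (n : ℤ) : Submodule ℂ (Mat E → ℂ) where
  carrier := {f | (∀ x, x ∉ Kset S → f x = 0) ∧
    (∀ b ∈ Bcal S, ∀ k ∈ Kset S, f (b * k) = χ (b 0 0) * f k) ∧
    (∀ k ∈ Kset S, ∀ g ∈ Kfil S n, f (k * g) = f k)}
  add_mem' := by
    rintro f g ⟨hf0, hf1, hf2⟩ ⟨hg0, hg1, hg2⟩
    refine ⟨fun x hx => ?_, fun b hb k hk => ?_, fun k hk g' hg' => ?_⟩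
    · simp [hf0 x hx, hg0 x hx]
    · simp only [Pi.add_apply, hf1 b hb k hk, hg1 b hb k hk]; ring
    · simp only [Pi.add_apply, hf2 k hk g' hg', hg2 k hk g' hg']
  zero_mem' := by
    refine ⟨fun x _ => rfl, fun b _ k _ => by simp, fun k _ g _ => rfl⟩
  smul_mem' := by
    rintro c f ⟨hf0, hf1, hf2⟩
    refine ⟨fun x hx => ?_, fun b hb k hk => ?_, fun k hk g' hg' => ?_⟩
    · simp [hf0 x hx]
    · simp only [Pi.smul_apply, hf1 b hb k hk, smul_eq_mul]; ring
    · simp only [Pi.smul_apply, hf2 k hk g' hg']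

/-- The space of the representation induced from a character `Ψ` of a subgroup `H ⊆ K`:
functions on `K` (extended by zero) with `f(hk) = Ψ(h) f(k)`. -/
def IndSp (S : USetting E) (H : Set (Mat E)) (Ψ : Mat E → ℂ) : Submodule ℂ (Mat E → ℂ) where
  carrier := {f | (∀ x, x ∉ Kset S → f x = 0) ∧
    ∀ h ∈ H, ∀ k ∈ Kset S, f (h * k) = Ψ h * f k}
  add_mem' := by
    rintro f g ⟨hf0, hf1⟩ ⟨hg0, hg1⟩
    refine ⟨fun x hx => ?_, fun h hh k hk => ?_⟩
    · simp [hf0 x hx, hg0 x hx]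
    · simp only [Pi.add_apply, hf1 h hh k hk, hg1 h hh k hk]; ring
  zero_mem' := ⟨fun x _ => rfl, fun h _ k _ => by simp⟩
  smul_mem' := by
    rintro c f ⟨hf0, hf1⟩
    refine ⟨fun x hx => ?_, fun h hh k hk => ?_⟩
    · simp [hf0 x hx]
    · simp only [Pi.smul_apply, hf1 h hh k hk, smul_eq_mul]; ring

/-- The functions constant on `K` and zero off `K`. -/
def ConstSub (S : USetting E) : Submodule ℂ (Mat E → ℂ) where
  carrier := {f | (∀ x, x ∉ Kset S → f x = 0) ∧ ∃ c : ℂ, ∀ k ∈ Kset S, f k = c}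
  add_mem' := by
    rintro f g ⟨hf0, c, hc⟩ ⟨hg0, c', hc'⟩
    exact ⟨fun x hx => by simp [hf0 x hx, hg0 x hx],
      c + c', fun k hk => by simp [hc k hk, hc' k hk]⟩
  zero_mem' := ⟨fun x _ => rfl, 0, fun _ _ => rfl⟩
  smul_mem' := by
    rintro a f ⟨hf0, c, hc⟩
    exact ⟨fun x hx => by simp [hf0 x hx], a * c, fun k hk => by simp [hc k hk]⟩

/-- A subspace is `K`-invariant. -/
def KInvariant (S : USetting E) (W : Submodule ℂ (Mat E → ℂ)) : Prop :=
  ∀ g ∈ Kset S, ∀ f ∈ W, rho g f ∈ W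

/-- A subset `A ⊆ K` acts trivially on `W`. -/
def ActsTrivially (S : USetting E) (A : Set (Mat E)) (W : Submodule ℂ (Mat E → ℂ)) : Prop :=
  ∀ g ∈ A, ∀ f ∈ W, rho g f = f

/-- `W` is an irreducible representation of `K`. -/
def IsIrredRep (S : USetting E) (W : Submodule ℂ (Mat E → ℂ)) : Prop :=
  W ≠ ⊥ ∧ KInvariant S W ∧
    ∀ U : Submodule ℂ (Mat E → ℂ), U ≤ W → KInvariant S U → U = ⊥ ∨ U = W

/-- `V` and `W` are isomorphic as representations of `K`. -/
def RepIso (S : USetting E) (V W : Submodule ℂ (Mat E → ℂ)) : Prop :=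
  ∃ e : (Mat E → ℂ) →ₗ[ℂ] (Mat E → ℂ), Set.BijOn ⇑e ↑V ↑W ∧
    ∀ g ∈ Kset S, ∀ f ∈ V, e (rho g f) = rho g (e f)

/-- The space of `ℂ`-linear endomorphisms of `V` commuting with the right-translation
action of `K`, realized inside the function space `↥V → ↥V`. -/
def Commutant (S : USetting E) (V : Submodule ℂ (Mat E → ℂ)) :
    Submodule ℂ (↥V → ↥V) where
  carrier := {T | (∀ x y : ↥V, T (x + y) = T x + T y) ∧
    (∀ (c : ℂ) (x : ↥V), T (c • x) = c • T x) ∧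
    ∀ g ∈ Kset S, ∀ f : ↥V, ∀ h : rho g (f : Mat E → ℂ) ∈ V,
      ((T ⟨rho g (f : Mat E → ℂ), h⟩ : ↥V) : Mat E → ℂ) = rho g ((T f : ↥V) : Mat E → ℂ)}
  add_mem' := by
    rintro T T' ⟨hT1, hT2, hT3⟩ ⟨hT1', hT2', hT3'⟩
    refine ⟨fun x y => ?_, fun c x => ?_, fun g hg f h => ?_⟩
    · simp only [Pi.add_apply, hT1 x y, hT1' x y]; abel
    · simp only [Pi.add_apply, hT2 c x, hT2' c x, smul_add]
    · simp only [Pi.add_apply, Submodule.coe_add, hT3 g hg f h, hT3' g hg f h, map_add]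
  zero_mem' := by
    refine ⟨fun x y => by simp, fun c x => by simp, fun g hg f h => by simp⟩
  smul_mem' := by
    rintro c T ⟨hT1, hT2, hT3⟩
    refine ⟨fun x y => ?_, fun a x => ?_, fun g hg f h => ?_⟩
    · simp only [Pi.smul_apply, hT1 x y, smul_add]
    · simp only [Pi.smul_apply, hT2 a x, smul_comm c a]
    · simp only [Pi.smul_apply, Submodule.coe_smul, hT3 g hg f h, _root_.map_smul]

/-- The additive character `ψ` of `E`, `ψ(x) = ψ'((x + σ(x))/2)`. -/
def psiE (S : USetting E) (x : E) : ℂ := S.psi' ((x + S.sig x) / 2)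

/-- `Ψ_Y(g) = ψ(Tr(Y (g − 1)))`. -/
def PsiC (S : USetting E) (Y g : Mat E) : ℂ := psiE S ((Y * (g - 1)).trace)

/-- The Lie algebra `𝔤 = 𝔲(1,1)(F)`. -/
def gfrak (S : USetting E) : Set (Mat E) :=
  {Y | (Y.map ⇑S.sig)ᵀ * w0 E + w0 E * Y = 0}

/-- The lattice `𝔨_s` of the Lie algebra, where `c = ⌈s⌉`. -/
def kfrakC (S : USetting E) (c : ℤ) : Set (Mat E) :=
  {Y | Y ∈ gfrak S ∧ (c : WithTop ℤ) ≤ S.nu (Y 0 0) ∧ (c : WithTop ℤ) ≤ S.nu (Y 1 1) ∧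
    (∃ t, S.sig t = t ∧ (c : WithTop ℤ) ≤ S.nu t ∧ Y 0 1 = S.sqeps * t) ∧
    (∃ t, S.sig t = t ∧ (c : WithTop ℤ) ≤ S.nu t ∧ Y 1 0 = S.sqeps * t)}

/-- The group `J_d`. -/
def Jgrp (S : USetting E) (d : ℕ) : Set (Mat E) :=
  {g | g ∈ Kset S ∧ ((((d + 1) / 2 : ℕ) : WithTop ℤ) ≤ S.nu (g 0 0 - 1)) ∧
    ((((d + 1) / 2 : ℕ) : WithTop ℤ) ≤ S.nu (g 0 1)) ∧
    ((((d + 1) / 2 : ℕ) : WithTop ℤ) ≤ S.nu (g 1 1 - 1)) ∧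
    (((d / 2 + 1 : ℕ) : WithTop ℤ) ≤ S.nu (g 1 0))}

/-- The centralizer `T(X)` in `K` of `X = [[z√ε, u√ε],[v√ε, z√ε]]`. -/
def TXset (S : USetting E) (u v : E) : Set (Mat E) :=
  {m | m ∈ Kset S ∧ m 1 1 = m 0 0 ∧ m 1 0 = m 0 1 * (u⁻¹ * v)}

/-- The center `Z` of `G`, identified with scalar matrices with entries in `E^1`. -/
def Zset (S : USetting E) : Set (Mat E) := {m | ∃ z ∈ E1set S, m = z • (1 : Mat E)}

/-- `𝒰 = U ∩ K`. -/
def Uset (S : USetting E) : Set (Mat E) :=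
  {m | ∃ b, S.sig b = b ∧ 0 ≤ S.nu b ∧ m = !![1, b * S.sqeps; 0, 1]}

/-- The set of products `T(X)·J_d`. -/
def TXJ (S : USetting E) (u v : E) (d : ℕ) : Set (Mat E) :=
  {x | ∃ t ∈ TXset S u v, ∃ j ∈ Jgrp S d, x = t * j}

/-- The set of products `Z·𝒰·J_d`. -/
def ZUJ (S : USetting E) (d : ℕ) : Set (Mat E) :=
  {x | ∃ z ∈ Zset S, ∃ m ∈ Uset S, ∃ j ∈ Jgrp S d, x = z * m * j}

/-- `X = [[z√ε, u√ε],[v√ε, z√ε]]`. -/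
def Xzuv (S : USetting E) (z u v : E) : Mat E :=
  !![z * S.sqeps, u * S.sqeps; v * S.sqeps, z * S.sqeps]

/-- The nilpotent element `X_δ = [[0, δ√ε],[0,0]]`. -/
def Xdelta (S : USetting E) (δ : E) : Mat E := !![0, δ * S.sqeps; 0, 0]

/-- `W` is a `K`-invariant complement of `V_χ^{K_d}` inside `V_χ^{K_{d+1}}`. -/
def Wcompl (S : USetting E) (χ : E → ℂ) (d : ℕ) (W : Submodule ℂ (Mat E → ℂ)) : Prop :=
  W ≤ Vsp S χ ((d : ℤ) + 1) ∧ KInvariant S W ∧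
    Vsp S χ (d : ℤ) ⊓ W = ⊥ ∧ Vsp S χ (d : ℤ) ⊔ W = Vsp S χ ((d : ℤ) + 1)

namespace USetting

/-- `S.Val n x` says that `x ∈ p_E^n`. -/
def Val (S : USetting E) (n : ℤ) (x : E) : Prop := (n : WithTop ℤ) ≤ S.nu x

variable {S : USetting E} {n k : ℤ} {x y : E}

lemma Val.mono (h : S.Val n x) (hk : k ≤ n) : S.Val k x :=
  le_trans (WithTop.coe_le_coe.2 hk) h

lemma Val.mul (hx : S.Val n x) (hy : S.Val k y) : S.Val (n + k) (x * y) := by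
  unfold Val at *
  rw [S.nu_mul, WithTop.coe_add]
  exact add_le_add hx hy

lemma Val.add (hx : S.Val n x) (hy : S.Val n y) : S.Val n (x + y) :=
  le_trans (le_min hx hy) (S.nu_add x y)

lemma nu_ne_top (S : USetting E) (hx : x ≠ 0) : S.nu x ≠ ⊤ :=
  fun h => hx ((S.nu_eq_top x).1 h)

lemma nu_one (S : USetting E) : S.nu 1 = 0 := by
  have h := S.nu_mul 1 1
  obtain ⟨a, ha⟩ := WithTop.ne_top_iff_exists.1 (S.nu_ne_top (one_ne_zero (α := E)))
  rw [mul_one, ← ha] at h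
  rw [← ha]
  norm_cast at h ⊢
  omega

lemma nu_neg (S : USetting E) (x : E) : S.nu (-x) = S.nu x := by
  have h := S.nu_mul (-1) (-1)
  obtain ⟨a, ha⟩ :=
    WithTop.ne_top_iff_exists.1 (S.nu_ne_top (neg_ne_zero.2 (one_ne_zero (α := E))))
  rw [neg_mul_neg, mul_one, S.nu_one, ← ha] at h
  have ha0 : a = 0 := by
    norm_cast at h
    omega
  rw [← neg_one_mul, S.nu_mul, ← ha, ha0]
  simp

lemma Val.neg (hx : S.Val n x) : S.Val n (-x) := by
  unfold Val at *
  rwa [S.nu_neg]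

lemma Val.sub (hx : S.Val n x) (hy : S.Val n y) : S.Val n (x - y) := by
  rw [sub_eq_add_neg]
  exact hx.add hy.neg

lemma Val.sig (hx : S.Val n x) : S.Val n (S.sig x) := by
  unfold Val at *
  rwa [S.nu_sig]

lemma val_zero (S : USetting E) (n : ℤ) : S.Val n 0 := by
  unfold Val
  rw [(S.nu_eq_top 0).2 rfl]
  exact le_top

lemma val_of_nu_eq (h : S.nu x = (n : WithTop ℤ)) : S.Val n x := h.ge

lemma val_one (S : USetting E) : S.Val 0 1 := S.nu_one.ge

lemma ne_zero_of_nu_eq (h : S.nu x = (n : WithTop ℤ)) : x ≠ 0 := by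
  rintro rfl
  rw [(S.nu_eq_top 0).2 rfl] at h
  exact WithTop.top_ne_coe h

lemma nu_inv (h : S.nu x = (n : WithTop ℤ)) : S.nu x⁻¹ = ((-n : ℤ) : WithTop ℤ) := by
  have hx := ne_zero_of_nu_eq h
  have hm := S.nu_mul x x⁻¹
  obtain ⟨a, ha⟩ := WithTop.ne_top_iff_exists.1 (S.nu_ne_top (inv_ne_zero hx))
  rw [mul_inv_cancel₀ hx, S.nu_one, h, ← ha] at hm
  rw [← ha]
  norm_cast at hm ⊢
  omega

lemma nu_pi_pow (S : USetting E) (m : ℕ) : S.nu (S.pi ^ m) = ((m : ℤ) : WithTop ℤ) := by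
  induction m with
  | zero => simpa using S.nu_one
  | succ m ih =>
    rw [pow_succ, S.nu_mul, ih, S.nu_pi]
    norm_cast

/-- Elements of `1 + p_E` are units. -/
lemma nu_eq_zero_of_val_sub_one (h : S.Val 1 (x - 1)) : S.nu x = 0 := by
  have h0 : S.Val 0 x := by
    simpa using (h.mono zero_le_one).add S.val_one
  refine le_antisymm ?_ h0
  by_contra hlt
  have h1 : S.Val 1 x := by
    unfold Val
    rw [not_le] at hlt
    by_cases hx : x = 0
    · rw [hx]
      exact S.val_zero 1
    obtain ⟨a, ha⟩ := WithTop.ne_top_iff_exists.1 (S.nu_ne_top hx)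
    rw [← ha] at hlt ⊢
    norm_cast at hlt ⊢
  have h2 : S.Val 1 1 := by simpa using h1.sub h
  unfold Val at h2
  rw [S.nu_one] at h2
  norm_cast at h2

/-- All entries of `M` lie in `p_E^n`. -/
def MatVal (S : USetting E) (n : ℤ) (M : Mat E) : Prop := ∀ i j, S.Val n (M i j)

variable {M N : Mat E}

lemma MatVal.mul (hM : S.MatVal n M) (hN : S.MatVal k N) : S.MatVal (n + k) (M * N) := by
  intro i j
  rw [Matrix.mul_apply, Fin.sum_univ_two]
  exact ((hM i 0).mul (hN 0 j)).add ((hM i 1).mul (hN 1 j))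

lemma MatVal.sub (hM : S.MatVal n M) (hN : S.MatVal n N) : S.MatVal n (M - N) :=
  fun i j => (hM i j).sub (hN i j)

lemma MatVal.trace (hM : S.MatVal n M) : S.Val n M.trace := by
  rw [Matrix.trace_fin_two]
  exact (hM 0 0).add (hM 1 1)

lemma val_half (hx : S.Val n x) : S.Val n (x / 2) := by
  have h2 : S.nu 2 = ((0 : ℤ) : WithTop ℤ) := S.nu_two
  have := hx.mul (val_of_nu_eq (nu_inv h2))
  simpa [div_eq_mul_inv] using this

lemma two_ne_zero' (S : USetting E) : (2 : E) ≠ 0 :=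
  ne_zero_of_nu_eq (n := 0) S.nu_two

lemma sig_half_trace (S : USetting E) (x : E) :
    S.sig ((x + S.sig x) / 2) = (x + S.sig x) / 2 := by
  rw [map_div₀, map_add, S.sig_invol, map_ofNat, add_comm]

lemma psiE_add (S : USetting E) (x y : E) : psiE S (x + y) = psiE S x * psiE S y := by
  unfold psiE
  rw [← S.psi'_mul _ _ (S.sig_half_trace x) (S.sig_half_trace y), map_add]
  congr 1
  ring

lemma psiE_ne_zero (S : USetting E) (x : E) : psiE S x ≠ 0 :=
  S.psi'_ne _ (S.sig_half_trace x)

lemma psiE_eq_one (hx : S.Val 1 x) : psiE S x = 1 :=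
  S.psi'_triv _ (S.sig_half_trace x) (val_half (hx.add hx.sig))

lemma psiE_congr (h : S.Val 1 (x - y)) : psiE S x = psiE S y := by
  rw [← sub_add_cancel x y, S.psiE_add, psiE_eq_one h, one_mul]

/-- An element `y` of `F` with `ψ'(y·O_F) = 1` lies in `p_F`. -/
lemma val_one_of_psi'_eq_one (hy : S.sig y = y)
    (h : ∀ r, S.sig r = r → S.Val 0 r → S.psi' (y * r) = 1) : S.Val 1 y := by
  by_contra hlt
  have hy0 : y ≠ 0 := by
    rintro rfl
    exact hlt (S.val_zero 1)
  obtain ⟨a, ha⟩ := WithTop.ne_top_iff_exists.1 (S.nu_ne_top hy0)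
  have ha0 : a ≤ 0 := by
    unfold Val at hlt
    rw [← ha, WithTop.coe_le_coe] at hlt
    omega
  obtain ⟨x, hx, hx0, hx1⟩ := S.psi'_nontriv
  apply hx1
  have hx0 : S.Val 0 x := hx0
  have := h (y⁻¹ * x) (by rw [map_mul, map_inv₀, hy, hx])
    (((val_of_nu_eq (nu_inv ha.symm)).mul hx0).mono (by omega))
  rwa [mul_inv_cancel_left₀ hy0] at this

lemma psi'_eq_psiE (S : USetting E) (c r : E) (hr : S.sig r = r) :
    S.psi' ((c + S.sig c) * r) = psiE S (2 * c * r) := by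
  unfold psiE
  congr 1
  rw [map_mul, map_mul, hr, map_ofNat]
  field_simp [S.two_ne_zero']

lemma isUnit_det_of_mem_Kset {g : Mat E} (hg : g ∈ Kset S) : IsUnit g.det :=
  isUnit_iff_ne_zero.2 (ne_zero_of_nu_eq (n := 0) hg.2.2)

lemma matVal_of_mem_Kset {g : Mat E} (hg : g ∈ Kset S) : S.MatVal 0 g := hg.2.1

lemma inv_eq_of_det (g : Mat E) :
    g⁻¹ = !![g.det⁻¹ * g 1 1, -(g.det⁻¹ * g 0 1); -(g.det⁻¹ * g 1 0), g.det⁻¹ * g 0 0] := by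
  rw [Matrix.inv_def, Matrix.adjugate_fin_two, Ring.inverse_eq_inv']
  ext i j
  fin_cases i <;> fin_cases j <;> simp

lemma mul_mem_Kset {g h : Mat E} (hg : g ∈ Kset S) (hh : h ∈ Kset S) : g * h ∈ Kset S := by
  refine ⟨?_, fun i j => ?_, ?_⟩
  · have h1 : (g.map S.sig)ᵀ * w0 E * g = w0 E := hg.1
    have h2 : (h.map S.sig)ᵀ * w0 E * h = w0 E := hh.1
    change ((g * h).map S.sig)ᵀ * w0 E * (g * h) = w0 E
    rw [Matrix.map_mul, Matrix.transpose_mul]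
    calc _ = (h.map S.sig)ᵀ * ((g.map S.sig)ᵀ * w0 E * g) * h := by
          simp only [Matrix.mul_assoc]
      _ = _ := by rw [h1, h2]
  · exact ((matVal_of_mem_Kset hg).mul (matVal_of_mem_Kset hh)) i j
  · rw [Matrix.det_mul, S.nu_mul, hg.2.2, hh.2.2, add_zero]

lemma inv_mem_Kset {g : Mat E} (hg : g ∈ Kset S) : g⁻¹ ∈ Kset S := by
  have hu := isUnit_det_of_mem_Kset hg
  have hD : S.Val 0 g.det⁻¹ := val_of_nu_eq (nu_inv (n := 0) hg.2.2)
  refine ⟨?_, fun i j => ?_, ?_⟩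
  · have h1 : (g.map S.sig)ᵀ * w0 E * g = w0 E := hg.1
    have h3 : (g⁻¹.map S.sig)ᵀ * (g.map S.sig)ᵀ = 1 := by
      rw [← Matrix.transpose_mul, ← Matrix.map_mul, Matrix.mul_nonsing_inv _ hu]
      simp
    change (g⁻¹.map S.sig)ᵀ * w0 E * g⁻¹ = w0 E
    calc _ = (g⁻¹.map S.sig)ᵀ * ((g.map S.sig)ᵀ * w0 E * g) * g⁻¹ := by rw [h1]
      _ = ((g⁻¹.map S.sig)ᵀ * (g.map S.sig)ᵀ) * w0 E * (g * g⁻¹) := by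
          simp only [Matrix.mul_assoc]
      _ = _ := by rw [h3, Matrix.mul_nonsing_inv _ hu, one_mul, mul_one]
  · change S.Val 0 (g⁻¹ i j)
    have hv := matVal_of_mem_Kset hg
    rw [inv_eq_of_det]
    fin_cases i <;> fin_cases j
    · exact hD.mul (hv 1 1)
    · exact (hD.mul (hv 0 1)).neg
    · exact (hD.mul (hv 1 0)).neg
    · exact hD.mul (hv 0 0)
  · rw [Matrix.det_nonsing_inv, Ring.inverse_eq_inv', nu_inv (n := 0) hg.2.2]
    rfl

variable {m : ℕ}

lemma mem_Jgrp_iff {g : Mat E} : g ∈ Jgrp S (m + m) ↔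
    g ∈ Kset S ∧ S.MatVal m (g - 1) ∧ S.Val (m + 1) ((g - 1) 1 0) := by
  have h1 : (m + m + 1) / 2 = m := by omega
  have h2 : (m + m) / 2 + 1 = m + 1 := by omega
  unfold Jgrp MatVal
  rw [Set.mem_ofPred_eq, h1, h2]
  have e10 : (g - 1) 1 0 = g 1 0 := by simp
  have e01 : (g - 1) 0 1 = g 0 1 := by simp
  have e00 : (g - 1) 0 0 = g 0 0 - 1 := by simp
  have e11 : (g - 1) 1 1 = g 1 1 - 1 := by simp
  simp only [Fin.forall_fin_two, e10, e01, e00, e11]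
  constructor
  · rintro ⟨hK, h00, h01, h11, h10⟩
    have h10' : S.Val (m + 1) (g 1 0) := h10
    exact ⟨hK, ⟨⟨h00, h01⟩, h10'.mono (by omega), h11⟩, h10'⟩
  · rintro ⟨hK, ⟨⟨h00, h01⟩, -, h11⟩, h10⟩
    exact ⟨hK, h00, h01, h11, h10⟩

/-- An element of `K` that is upper triangular modulo `p_E` conjugates `J_d` into itself. -/
lemma conj_mem_Jgrp {k x : Mat E} (hk : k ∈ Kset S) (hk10 : S.Val 1 (k 1 0))
    (hx : x ∈ Jgrp S (m + m)) : k * x * k⁻¹ ∈ Jgrp S (m + m) := by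
  rw [mem_Jgrp_iff] at hx ⊢
  obtain ⟨hxK, hxm, hx10⟩ := hx
  have hki := inv_mem_Kset hk
  have e : k * x * k⁻¹ - 1 = k * (x - 1) * k⁻¹ := by
    rw [mul_sub, sub_mul, mul_one, Matrix.mul_nonsing_inv _ (isUnit_det_of_mem_Kset hk)]
  have hkv := matVal_of_mem_Kset hk
  have hD : S.Val 0 k.det⁻¹ := val_of_nu_eq (nu_inv (n := 0) hk.2.2)
  rw [e]
  refine ⟨mul_mem_Kset (mul_mem_Kset hk hxK) hki, ?_, ?_⟩
  · simpa using ((matVal_of_mem_Kset hk).mul hxm).mul (matVal_of_mem_Kset hki)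
  · have key : (k * (x - 1) * k⁻¹) 1 0 = k.det⁻¹ *
        (k 1 0 * (k 1 1 * ((x - 1) 0 0) - k 1 0 * ((x - 1) 0 1) - k 1 1 * ((x - 1) 1 1))
          + k 1 1 * k 1 1 * ((x - 1) 1 0)) := by
      rw [inv_eq_of_det]
      generalize x - 1 = B
      simp only [Matrix.mul_apply, Fin.sum_univ_two, Matrix.of_apply, Matrix.cons_val',
        Matrix.cons_val_zero, Matrix.cons_val_one]
      ring
    rw [key]
    refine (hD.mul (Val.add (n := m + 1) ?_ ?_)).mono (by omega)
    · refine (hk10.mul (((((hkv 1 1).mul (hxm 0 0)).mono ?_).sub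
        (((hkv 1 0).mul (hxm 0 1)).mono ?_)).sub (((hkv 1 1).mul (hxm 1 1)).mono ?_))
          (k := m)).mono ?_ <;> omega
    · exact (((hkv 1 1).mul (hkv 1 1)).mul hx10).mono (by omega)

lemma image_conj_Jgrp {k : Mat E} (hk : k ∈ Kset S) (hk10 : S.Val 1 (k 1 0)) :
    (fun x => k * x * k⁻¹) '' Jgrp S (m + m) = Jgrp S (m + m) := by
  have hu := isUnit_det_of_mem_Kset hk
  have hki := inv_mem_Kset hk
  have hki10 : S.Val 1 (k⁻¹ 1 0) := by
    have hD : S.Val 0 k.det⁻¹ := val_of_nu_eq (nu_inv (n := 0) hk.2.2)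
    rw [inv_eq_of_det]
    exact (hD.mul hk10).neg
  apply Set.Subset.antisymm
  · rintro _ ⟨x, hx, rfl⟩
    exact conj_mem_Jgrp hk hk10 hx
  · intro y hy
    refine ⟨k⁻¹ * y * k, ?_, ?_⟩
    · have := conj_mem_Jgrp hki hki10 hy
      rwa [Matrix.nonsing_inv_nonsing_inv _ hu] at this
    · change k * (k⁻¹ * y * k) * k⁻¹ = y
      calc _ = (k * k⁻¹) * y * (k * k⁻¹) := by simp only [Matrix.mul_assoc]
        _ = y := by rw [Matrix.mul_nonsing_inv _ hu, one_mul, mul_one]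

/-- Elements of `T(X)` commute with `X`, so conjugation by them preserves `Ψ_X`. -/
lemma PsiC_conj_of_mem_TXset {z u v : E} {t : Mat E} (hu : u ≠ 0) (ht : t ∈ TXset S u v)
    (y : Mat E) : PsiC S (Xzuv S z u v) (t * y * t⁻¹) = PsiC S (Xzuv S z u v) y := by
  obtain ⟨hK, h11, h10⟩ := ht
  have hdet := isUnit_det_of_mem_Kset hK
  have hcomm : Xzuv S z u v * t = t * Xzuv S z u v := by
    ext i j
    fin_cases i <;> fin_cases j <;>
      simp [Xzuv, Matrix.mul_apply, Fin.sum_univ_two, h11, h10] <;> field_simp <;> ring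
  unfold PsiC
  congr 1
  have e : t * y * t⁻¹ - 1 = t * (y - 1) * t⁻¹ := by
    rw [mul_sub, sub_mul, mul_one, Matrix.mul_nonsing_inv _ hdet]
  rw [e, ← Matrix.mul_assoc, Matrix.trace_mul_comm, ← Matrix.mul_assoc, ← Matrix.mul_assoc,
    Matrix.mul_assoc t⁻¹, hcomm, ← Matrix.mul_assoc, Matrix.nonsing_inv_mul _ hdet, one_mul]

/-- For `g ∈ K_m`, conjugation by `g` changes `Tr(X(x - 1))`, `x ∈ J_{2m}`, modulo `p_E` only by the
contribution of the lower left entry of the commutator. -/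
lemma val_trace_conj_sub {z u v : E} {g x : Mat E} (hm : 0 < m)
    (hnz : S.Val (-(m + m)) z) (hnu : S.Val (-(m + m)) u) (hnv : S.Val (-(m + m) + 1) v)
    (hg : g ∈ Kset S) (hgm : S.MatVal m (g - 1)) (hx : x ∈ Jgrp S (m + m)) :
    S.Val 1 ((Xzuv S z u v * (g * x * g⁻¹ - 1)).trace - ((Xzuv S z u v * (x - 1)).trace +
      u * S.sqeps * (g - 1) 1 0 * ((x - 1) 0 0 - (x - 1) 1 1))) := by
  rw [mem_Jgrp_iff] at hx
  obtain ⟨hxK, hxm, hx10⟩ := hx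
  have hs : S.Val 0 S.sqeps := S.nu_sqeps.ge
  have hdet := isUnit_det_of_mem_Kset hg
  have hXv : S.MatVal (-(m + m)) (Xzuv S z u v) := by
    intro i j
    fin_cases i <;> fin_cases j
    · exact (hnz.mul hs).mono (by omega)
    · exact (hnu.mul hs).mono (by omega)
    · exact (hnv.mul hs).mono (by omega)
    · exact (hnz.mul hs).mono (by omega)
  have hNv := matVal_of_mem_Kset (inv_mem_Kset hg)
  have hgN := Matrix.mul_nonsing_inv _ hdet
  set N := g⁻¹ with hN
  obtain ⟨A, rfl⟩ : ∃ A, g = 1 + A := ⟨g - 1, by abel⟩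
  obtain ⟨B, rfl⟩ : ∃ B, x = 1 + B := ⟨x - 1, by abel⟩
  simp only [add_sub_cancel_left] at *
  have hN1 : N = 1 - A * N := by
    rw [← hgN]
    noncomm_ring
  have e : (1 + A) * (1 + B) * N - 1 = B + (A * B - B * A) - (A * B - B * A) * (A * N) := by
    have : (1 + A) * (1 + B) * N = (1 + A) * N + B * ((1 + A) * N) + (A * B - B * A) * N := by
      noncomm_ring
    rw [this, hgN]
    nth_rewrite 1 [hN1]
    noncomm_ring
  have hW : S.Val 1 (Xzuv S z u v * ((A * B - B * A) * (A * N))).trace := by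
    have hC : S.MatVal (m + m) (A * B - B * A) := (hgm.mul hxm).sub (hxm.mul hgm)
    exact (hXv.mul (hC.mul (hgm.mul hNv))).trace.mono (by omega)
  have e2 : (Xzuv S z u v * ((1 + A) * (1 + B) * N - 1)).trace - ((Xzuv S z u v * B).trace +
      u * S.sqeps * A 1 0 * (B 0 0 - B 1 1)) =
      u * S.sqeps * ((A 1 1 - A 0 0) * B 1 0) +
        v * S.sqeps * (A 0 0 * B 0 1 + A 0 1 * B 1 1 - (B 0 0 * A 0 1 + B 0 1 * A 1 1)) -
        (Xzuv S z u v * ((A * B - B * A) * (A * N))).trace := by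
    rw [e, mul_sub, mul_add, Matrix.trace_sub, Matrix.trace_add]
    have : (Xzuv S z u v * (A * B - B * A)).trace =
        u * S.sqeps * ((A 1 1 - A 0 0) * B 1 0) + u * S.sqeps * A 1 0 * (B 0 0 - B 1 1) +
        v * S.sqeps * (A 0 0 * B 0 1 + A 0 1 * B 1 1 - (B 0 0 * A 0 1 + B 0 1 * A 1 1)) := by
      simp only [Xzuv, Matrix.trace_fin_two, Matrix.mul_apply, Fin.sum_univ_two, Matrix.sub_apply,
        Matrix.of_apply, Matrix.cons_val', Matrix.cons_val_zero, Matrix.cons_val_one]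
      ring
    rw [this]
    ring
  rw [e2]
  refine Val.sub (Val.add ?_ ?_) hW
  · exact ((hnu.mul hs).mul (((hgm 1 1).sub (hgm 0 0)).mul hx10)).mono (by omega)
  · exact ((hnv.mul hs).mul ((((hgm 0 0).mul (hxm 0 1)).add ((hgm 0 1).mul (hxm 1 1))).sub
      (((hxm 0 0).mul (hgm 0 1)).add ((hxm 0 1).mul (hgm 1 1))))).mono (by omega)

/-- The diagonal element `diag(s, s⁻¹)`, `s ∈ 1 + p_F^m`, lies in `J_{2m}`. -/
lemma diag_mem_Jgrp {s : E} (hm : 0 < m) (hs : S.sig s = s) (hs1 : S.Val m (s - 1)) :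
    !![s, 0; 0, s⁻¹] ∈ Jgrp S (m + m) := by
  have hs0 : S.nu s = ((0 : ℤ) : WithTop ℤ) :=
    nu_eq_zero_of_val_sub_one (hs1.mono (by omega))
  have hne : s ≠ 0 := ne_zero_of_nu_eq hs0
  have hinv := val_of_nu_eq (nu_inv hs0)
  have hinv1 : S.Val m (s⁻¹ - 1) := by
    have : s⁻¹ - 1 = -((s - 1) * s⁻¹) := by
      field_simp
      ring
    rw [this]
    exact (hs1.mul hinv).neg.mono (by omega)
  rw [mem_Jgrp_iff]
  refine ⟨⟨?_, ?_, ?_⟩, ?_, ?_⟩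
  · change ((!![s, 0; 0, s⁻¹] : Mat E).map S.sig)ᵀ * w0 E * !![s, 0; 0, s⁻¹] = w0 E
    ext i j
    fin_cases i <;> fin_cases j <;>
      simp [w0, Matrix.mul_apply, Fin.sum_univ_two, hs, hne]
  · intro i j
    fin_cases i <;> fin_cases j
    · exact val_of_nu_eq hs0
    · exact S.val_zero 0
    · exact S.val_zero 0
    · exact hinv
  · rw [Matrix.det_fin_two_of, mul_inv_cancel₀ hne, mul_zero, sub_zero, S.nu_one]
  · intro i j
    fin_cases i <;> fin_cases j
    · simpa using hs1
    · simpa using S.val_zero m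
    · simpa using S.val_zero m
    · simpa using hinv1
  · simpa using S.val_zero (m + 1)

/-- An element of `K_m` that fixes `Ψ_X` on `J_{2m}` lies in `J_{2m}`. -/
lemma mem_Jgrp_of_PsiC_conj {z u v : E} {g : Mat E} (hm : 0 < m)
    (hu : S.sig u = u) (hnz : S.Val (-(m + m)) z)
    (hnu : S.nu u = ((-(m + m) : ℤ) : WithTop ℤ)) (hnv : S.Val (-(m + m) + 1) v)
    (hg : g ∈ Kset S) (hgm : S.MatVal m (g - 1))
    (hstab : ∀ x ∈ Jgrp S (m + m),
      PsiC S (Xzuv S z u v) (g * x * g⁻¹) = PsiC S (Xzuv S z u v) x) :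
    g ∈ Jgrp S (m + m) := by
  have huv := val_of_nu_eq hnu
  have hs : S.Val 0 S.sqeps := S.nu_sqeps.ge
  have hpi := S.nu_pi_pow m
  have hpiv := val_of_nu_eq hpi
  have hsigpi : S.sig (S.pi ^ m) = S.pi ^ m := by rw [map_pow, S.sig_pi]
  set A10 := (g - 1) 1 0 with hA10
  set c := u * S.sqeps * A10 with hc
  have hcv : S.Val (-m) c := ((huv.mul hs).mul (hgm 1 0)).mono (by omega)
  have hre : S.Val 1 ((c + S.sig c) * S.pi ^ m) := by
    refine val_one_of_psi'_eq_one ?_ fun r hr hr0 => ?_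
    · rw [map_mul, map_add, S.sig_invol, hsigpi, add_comm]
    · have hpr : S.Val m (S.pi ^ m * r) := (hpiv.mul hr0).mono (by omega)
      have hsig : S.sig (S.pi ^ m * r) = S.pi ^ m * r := by rw [map_mul, hsigpi, hr]
      rw [mul_assoc, S.psi'_eq_psiE _ _ hsig]
      obtain ⟨s, hsdef⟩ : ∃ s, S.pi ^ m * r = s - 1 := ⟨1 + S.pi ^ m * r, by ring⟩
      rw [hsdef] at hpr hsig ⊢
      have hss : S.sig s = s := by
        rw [map_sub, map_one] at hsig
        exact sub_left_injective hsig
      have hs0 : S.nu s = ((0 : ℤ) : WithTop ℤ) :=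
        nu_eq_zero_of_val_sub_one (hpr.mono (by omega))
      have hne : s ≠ 0 := ne_zero_of_nu_eq hs0
      have hxJ := diag_mem_Jgrp hm hss hpr
      have h1 := psiE_congr (val_trace_conj_sub hm hnz huv hnv hg hgm hxJ)
      have h2 := hstab _ hxJ
      unfold PsiC at h2
      rw [S.psiE_add, h2] at h1
      have h3 := (mul_right_eq_self₀.1 h1.symm).resolve_right (S.psiE_ne_zero _)
      rw [← h3]
      apply psiE_congr
      have : 2 * c * (s - 1) - u * S.sqeps * (g - 1) 1 0 *
          (((!![s, 0; 0, s⁻¹] : Mat E) - 1) 0 0 - ((!![s, 0; 0, s⁻¹] : Mat E) - 1) 1 1) =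
          c * ((s - 1) * (s - 1) * s⁻¹) := by
        rw [← hA10, ← hc]
        simp
        field_simp
        ring
      rw [this]
      exact (hcv.mul ((hpr.mul hpr).mul (val_of_nu_eq (nu_inv hs0)))).mono (by omega)
  have him : S.Val 1 ((c - S.sig c) * S.pi ^ m) := by
    have hG : S.sig (g 0 0) * g 1 0 + S.sig (g 1 0) * g 0 0 = 0 := by
      have h : (g.map S.sig)ᵀ * w0 E * g = w0 E := hg.1
      have := congrFun (congrFun h 0) 0
      simpa [w0, Matrix.mul_apply, Fin.sum_univ_two, add_comm] using this
    have h00 : g 0 0 = 1 + (g - 1) 0 0 := by simp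
    have h10 : g 1 0 = A10 := by simp [hA10]
    rw [h00, h10, map_add, map_one] at hG
    have e : (c - S.sig c) * S.pi ^ m = -(u * S.sqeps *
        (S.sig ((g - 1) 0 0) * A10 + S.sig A10 * (g - 1) 0 0) * S.pi ^ m) := by
      rw [hc, map_mul, map_mul, hu, S.sig_sqeps]
      linear_combination (u * S.sqeps * S.pi ^ m) * hG
    rw [e]
    exact (((huv.mul hs).mul (((hgm 0 0).sig.mul (hgm 1 0)).add
      ((hgm 1 0).sig.mul (hgm 0 0)))).mul hpiv).neg.mono (by omega)
  rw [mem_Jgrp_iff]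
  refine ⟨hg, hgm, ?_⟩
  have hne1 := ne_zero_of_nu_eq hnu
  have hne2 : S.sqeps ≠ 0 := ne_zero_of_nu_eq (n := 0) S.nu_sqeps
  have hne3 := ne_zero_of_nu_eq hpi
  have e : (g - 1) 1 0 = ((c + S.sig c) * S.pi ^ m + (c - S.sig c) * S.pi ^ m) / 2 *
      (u⁻¹ * S.sqeps⁻¹ * (S.pi ^ m)⁻¹) := by
    rw [← hA10, hc]
    field_simp [S.two_ne_zero']
    ring
  rw [e]
  exact ((val_half (hre.add him)).mul (((val_of_nu_eq (nu_inv hnu)).mul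
    (val_of_nu_eq (nu_inv (n := 0) S.nu_sqeps))).mul (val_of_nu_eq (nu_inv hpi)))).mono (by omega)

end USetting

/-- for even `d > 0`, the normalizer of the character `Ψ_X` of `J_d` inside
`T(X)·K_{d/2}` equals `T(X)·J_d`. -/
theorem stmt14 (S : USetting E) (d : ℕ) (hd : 0 < d) (heven : Even d) (z u v : E)
    (hz : S.sig z = z) (hu : S.sig u = u) (hv : S.sig v = v)
    (hnz : ((-(d : ℤ) : ℤ) : WithTop ℤ) ≤ S.nu z)
    (hnu : S.nu u = ((-(d : ℤ) : ℤ) : WithTop ℤ))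
    (hnv : ((-(d : ℤ) : ℤ) : WithTop ℤ) < S.nu v) :
    {h : Mat E | (∃ t ∈ TXset S u v, ∃ g ∈ Kfil S ((d / 2 : ℕ) : ℤ), h = t * g) ∧
        (fun x => h * x * h⁻¹) '' Jgrp S d = Jgrp S d ∧
        ∀ g ∈ Jgrp S d, PsiC S (Xzuv S z u v) (h * g * h⁻¹) = PsiC S (Xzuv S z u v) g}
      = TXJ S u v d := by
  obtain ⟨m, rfl⟩ := heven
  have hm : 0 < m := by omega
  have hdm : (m + m) / 2 = m := by omega
  rw [hdm]
  rw [Nat.cast_add] at hnz hnu hnv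
  have hu0 : u ≠ 0 := USetting.ne_zero_of_nu_eq hnu
  have hnz' : S.Val (-(m + m)) z := hnz
  have huv : S.Val (-(m + m)) u := USetting.val_of_nu_eq hnu
  have hnv' : S.Val (-(m + m) + 1) v := by
    by_cases hv0 : v = 0
    · rw [hv0]
      exact S.val_zero _
    obtain ⟨a, ha⟩ := WithTop.ne_top_iff_exists.1 (S.nu_ne_top hv0)
    unfold USetting.Val
    rw [← ha, WithTop.coe_lt_coe] at hnv
    rw [← ha, WithTop.coe_le_coe]
    omega
  ext h
  constructor
  · rintro ⟨⟨t, ht, g, hg, rfl⟩, -, hstab⟩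
    refine ⟨t, ht, g, ?_, rfl⟩
    refine USetting.mem_Jgrp_of_PsiC_conj hm hu hnz' hnu hnv' hg.1 hg.2 fun x hx => ?_
    rw [← hstab x hx, ← USetting.PsiC_conj_of_mem_TXset hu0 ht (g * x * g⁻¹), Matrix.mul_inv_rev]
    simp only [Matrix.mul_assoc]
  · rintro ⟨t, ht, j, hj, rfl⟩
    have hj' := USetting.mem_Jgrp_iff.1 hj
    have hj10 : S.Val 1 (j 1 0) := by
      have : (j - 1) 1 0 = j 1 0 := by simp
      rw [← this]
      exact hj'.2.2.mono (by omega)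
    have ht10 : S.Val 1 (t 1 0) := by
      rw [ht.2.2]
      exact ((USetting.matVal_of_mem_Kset ht.1 0 1).mul
        ((USetting.val_of_nu_eq (USetting.nu_inv hnu)).mul hnv')).mono (by omega)
    refine ⟨⟨t, ht, j, ⟨hj.1, hj'.2.1⟩, rfl⟩, ?_, fun x hx => ?_⟩
    · apply USetting.image_conj_Jgrp (USetting.mul_mem_Kset ht.1 hj.1)
      rw [Matrix.mul_apply, Fin.sum_univ_two]
      exact ((ht10.mul (USetting.matVal_of_mem_Kset hj.1 0 0)).mono (by omega)).add
        (((USetting.matVal_of_mem_Kset ht.1 1 1).mul hj10).mono (by omega))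
    · have e : t * j * x * (t * j)⁻¹ = t * (j * x * j⁻¹) * t⁻¹ := by
        rw [Matrix.mul_inv_rev]
        simp only [Matrix.mul_assoc]
      rw [e, USetting.PsiC_conj_of_mem_TXset hu0 ht]
      unfold PsiC
      rw [USetting.psiE_congr (USetting.val_trace_conj_sub hm hnz' huv hnv' hj.1 hj'.2.1 hx),
        S.psiE_add]
      have hxm := (USetting.mem_Jgrp_iff.1 hx).2.1
      refine mul_eq_left₀ (S.psiE_ne_zero _) |>.2 (USetting.psiE_eq_one ?_)
      exact (((huv.mul (S.nu_sqeps.ge : S.Val 0 S.sqeps)).mul hj'.2.2).mul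
        ((hxm 0 0).sub (hxm 1 1))).mono (by omega)
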